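/- Lyapunov theorem: Let B be a real d×d Hurwitz matrix, i.e., every eigenvalue of B (over ℂ) has strictly negative real part. Then for every symmetric positive semidefinite d×d matrix Q there exists a unique symmetric positive semidefinite d×d matrix P satisfying the Lyapunov equation BᵀP + PB = −Q; moreover this P is the unique solution of the equation among all d×d matrices, and if Q is symmetric positive definite then P is symmetric positive definite. -/

import Mathlib

open Matrix

open Filter Topology in
/-- In a complex Banach algebra, the powers of an element whose spectrum lies in the open unit
disc tend to zero. -/
theorem tendsto_pow_zero_of_spectrum_subset_ball {A : Type*} [NormedRing A] [NormedAlgebra ℂ A]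
    [CompleteSpace A] (a : A) (ha : ∀ z ∈ spectrum ℂ a, ‖z‖ < 1) :
    Tendsto (fun n : ℕ => a ^ n) atTop (𝓝 0) := by
  nontriviality A
  have hr : spectralRadius ℂ a < 1 := by
    exact_mod_cast spectrum.spectralRadius_lt_of_forall_lt a (r := 1)
      fun z hz => by exact_mod_cast ha z hz
  obtain ⟨r, hr₁, hr₂⟩ := ENNReal.lt_iff_exists_nnreal_btwn.1 hr
  have hr₂' : r < 1 := by exact_mod_cast hr₂
  refine squeeze_zero_norm' ?_
    (tendsto_pow_atTop_nhds_zero_of_lt_one r.coe_nonneg (by exact_mod_cast hr₂'))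
  filter_upwards [(spectrum.pow_nnnorm_pow_one_div_tendsto_nhds_spectralRadius a).eventually_lt_const
    hr₁, eventually_gt_atTop 0] with n hn hn0
  have hn' : (n : ℝ) ≠ 0 := by exact_mod_cast hn0.ne'
  have h := ENNReal.rpow_le_rpow hn.le (Nat.cast_nonneg (α := ℝ) n)
  rw [← ENNReal.rpow_mul, one_div_mul_cancel hn', ENNReal.rpow_one, ENNReal.rpow_natCast] at h
  exact_mod_cast h

/-- The Cayley transform `(1 + a) (1 - a)⁻¹` of an element with spectrum in the open left half
plane has spectrum in the open unit disc. -/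
theorem norm_lt_one_of_mem_spectrum_cayley {A : Type*} [Ring A] [Algebra ℂ A] {a s : A}
    (ha : ∀ z ∈ spectrum ℂ a, z.re < 0) (h₁ : (1 - a) * s = 1) (h₂ : s * (1 - a) = 1) :
    ∀ z ∈ spectrum ℂ ((1 + a) * s), ‖z‖ < 1 := by
  intro z hz
  by_contra! hz1
  refine hz ?_
  have hs : IsUnit s := ⟨⟨s, 1 - a, h₂, h₁⟩, rfl⟩
  suffices h : IsUnit (algebraMap ℂ A (z - 1) - algebraMap ℂ A (z + 1) * a) by
    change IsUnit (algebraMap ℂ A z - (1 + a) * s)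
    convert h.mul hs using 1
    calc algebraMap ℂ A z - (1 + a) * s
        = algebraMap ℂ A z * ((1 - a) * s) - (1 + a) * s := by rw [h₁, mul_one]
      _ = _ := by simp only [map_sub, map_add, map_one]; noncomm_ring
  by_cases hz0 : z + 1 = 0
  · rw [hz0, map_zero, zero_mul, sub_zero]
    refine IsUnit.map (algebraMap ℂ A) (Ne.isUnit fun h => ?_)
    have : (2 : ℂ) = 0 := by linear_combination hz0 - h
    norm_num at this
  · have hmem : (z - 1) / (z + 1) ∉ spectrum ℂ a := fun h => by
      refine (ha _ h).not_ge ?_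
      have hsq : 1 ≤ Complex.normSq z := by
        rw [Complex.normSq_eq_norm_sq]; nlinarith
      rw [Complex.normSq_apply] at hsq
      rw [Complex.div_re, ← add_div]
      refine div_nonneg ?_ (Complex.normSq_nonneg _)
      simp only [Complex.sub_re, Complex.add_re, Complex.sub_im, Complex.add_im, Complex.one_re,
        Complex.one_im]
      nlinarith
    have h := (IsUnit.map (algebraMap ℂ A) (Ne.isUnit hz0)).mul (spectrum.notMem_iff.1 hmem)
    rwa [mul_sub, ← map_mul, mul_div_cancel₀ _ hz0] at h

section

open Filter Topology

attribute [local instance] Matrix.linftyOpNormedRing Matrix.linftyOpNormedAlgebra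

/-- The Cayley transform of a real Hurwitz matrix exists, and its powers tend to zero. -/
theorem Matrix.exists_cayley_pow_tendsto_zero {n : Type*} [Fintype n] [DecidableEq n]
    (B : Matrix n n ℝ) (hB : ∀ z ∈ spectrum ℂ (B.map Complex.ofReal), z.re < 0) :
    ∃ S : Matrix n n ℝ, (1 - B) * S = 1 ∧ S * (1 - B) = 1 ∧
      Tendsto (fun k : ℕ => ((1 + B) * S) ^ k) atTop (𝓝 0) := by
  let φ : Matrix n n ℝ →+* Matrix n n ℂ := Complex.ofRealHom.mapMatrix
  have hB' : ∀ z ∈ spectrum ℂ (φ B), z.re < 0 := hB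
  have h1 : IsUnit (1 - φ B) := by
    have : (1 : ℂ) ∉ spectrum ℂ (φ B) := fun h => by
      have := hB' 1 h
      norm_num at this
    simpa using spectrum.notMem_iff.1 this
  have hdet : IsUnit (1 - B).det := by
    refine Ne.isUnit fun h => ((Matrix.isUnit_iff_isUnit_det _).1 h1).ne_zero ?_
    rw [← map_one φ, ← map_sub, ← RingHom.map_det, h, map_zero]
  have hr := Matrix.mul_nonsing_inv _ hdet
  have hl := Matrix.nonsing_inv_mul _ hdet
  refine ⟨(1 - B)⁻¹, hr, hl, ?_⟩
  have hc : Tendsto (fun k : ℕ => ((1 + φ B) * φ (1 - B)⁻¹) ^ k) atTop (𝓝 0) := by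
    refine tendsto_pow_zero_of_spectrum_subset_ball _
      (norm_lt_one_of_mem_spectrum_cayley hB' ?_ ?_)
    · rw [← map_one φ, ← map_sub, ← map_mul, hr]
    · rw [← map_one φ, ← map_sub, ← map_mul, hl]
  have hre : Continuous fun M : Matrix n n ℂ => M.map Complex.re :=
    continuous_id.matrix_map Complex.continuous_re
  convert (hre.tendsto 0).comp hc using 1
  · ext k i j
    simp only [Function.comp_apply]
    rw [← map_one φ, ← map_add, ← map_mul, ← map_pow]
    simp [φ]
  · simp

end

open Filter Topology in
/-- If the powers of `A` tend to zero, then so do the congruences of `P` by those powers. -/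
theorem Matrix.tendsto_transpose_pow_mul_mul_pow {n : Type*} [Fintype n] [DecidableEq n]
    {A : Matrix n n ℝ} (hA : Tendsto (fun k : ℕ => A ^ k) atTop (𝓝 0)) (P : Matrix n n ℝ) :
    Tendsto (fun k : ℕ => (A ^ k)ᵀ * P * A ^ k) atTop (𝓝 0) := by
  have hc : Continuous fun M : Matrix n n ℝ => Mᵀ * P * M := by fun_prop
  simpa [Function.comp_def] using (hc.tendsto 0).comp hA

open Filter Topology in
/-- A discrete-time Lyapunov inequality `P - Aᵀ P A ≥ 0` with `A ^ k → 0` forces `P ≥ 0`. -/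
theorem Matrix.PosSemidef.of_sub_transpose_mul_mul {n : Type*} [Fintype n] [DecidableEq n]
    {A P : Matrix n n ℝ} (hA : Tendsto (fun k : ℕ => A ^ k) atTop (𝓝 0)) (hP : P.IsHermitian)
    (h : (P - Aᵀ * P * A).PosSemidef) : P.PosSemidef := by
  have hk (k : ℕ) : (P - (A ^ k)ᵀ * P * A ^ k).PosSemidef := by
    induction k with
    | zero => simpa using Matrix.PosSemidef.zero
    | succ k ih =>
      have h' := ih.add (h.conjTranspose_mul_mul_same (A ^ k))
      convert h' using 1
      rw [pow_succ', transpose_mul, conjTranspose_eq_transpose_of_trivial]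
      noncomm_ring
  refine .of_dotProduct_mulVec_nonneg hP fun x => ?_
  have hc : Continuous fun M : Matrix n n ℝ => star x ⬝ᵥ ((P - M) *ᵥ x) := by fun_prop
  have ht := (hc.tendsto 0).comp (Matrix.tendsto_transpose_pow_mul_mul_pow hA P)
  rw [sub_zero] at ht
  exact ge_of_tendsto' ht fun k => (hk k).dotProduct_mulVec_nonneg x

/-- The Cayley transform turns the continuous-time Lyapunov operator into the discrete-time one. -/
theorem Matrix.sub_cayley_transpose_mul_mul {n : Type*} [Fintype n] [DecidableEq n]
    {B S : Matrix n n ℝ} (hS : (1 - B) * S = 1) (P : Matrix n n ℝ) :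
    P - ((1 + B) * S)ᵀ * P * ((1 + B) * S) = (2 : ℝ) • (Sᵀ * -(Bᵀ * P + P * B) * S) := by
  have hP : P = ((1 - B) * S)ᵀ * P * ((1 - B) * S) := by simp [hS]
  nth_rewrite 1 [hP]
  simp only [transpose_mul, transpose_add, transpose_sub, transpose_one, two_smul]
  noncomm_ring

/-- The Lyapunov operator `P ↦ Bᵀ P + P B` as a linear map. -/
def Matrix.lyapunovMap {n : Type*} [Fintype n] (B : Matrix n n ℝ) :
    Matrix n n ℝ →ₗ[ℝ] Matrix n n ℝ where
  toFun P := Bᵀ * P + P * B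
  map_add' P P' := by rw [Matrix.mul_add, Matrix.add_mul]; abel
  map_smul' c P := by simp

/-- **Lyapunov theorem.** If `B` is a real Hurwitz matrix (all eigenvalues of `B`, viewed
as a complex matrix, have strictly negative real part), then for every symmetric positive
semidefinite `Q` there is a positive semidefinite solution `P` of the Lyapunov equation
`Bᵀ P + P B = -Q`, this `P` is the unique solution among all matrices, and if `Q` is
positive definite then so is `P`. -/
theorem lyapunov_theorem {d : ℕ} (B : Matrix (Fin d) (Fin d) ℝ)
    (hB : ∀ z ∈ spectrum ℂ (B.map Complex.ofReal), z.re < 0)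
    (Q : Matrix (Fin d) (Fin d) ℝ) (hQ : Q.PosSemidef) :
    ∃ P : Matrix (Fin d) (Fin d) ℝ,
      (Bᵀ * P + P * B = -Q) ∧ P.PosSemidef ∧
      (∀ P' : Matrix (Fin d) (Fin d) ℝ, Bᵀ * P' + P' * B = -Q → P' = P) ∧
      (Q.PosDef → P.PosDef) := by
  obtain ⟨S, hS, hS', hlim⟩ := Matrix.exists_cayley_pow_tendsto_zero B hB
  have hinj : Function.Injective B.lyapunovMap := by
    refine (injective_iff_map_eq_zero _).2 fun P hP => ?_
    have hP' : Bᵀ * P + P * B = 0 := hP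
    have hinv := Matrix.sub_cayley_transpose_mul_mul hS P
    rw [hP', neg_zero, mul_zero, zero_mul, smul_zero, sub_eq_zero] at hinv
    have hk (k : ℕ) : (((1 + B) * S) ^ k)ᵀ * P * ((1 + B) * S) ^ k = P := by
      induction k with
      | zero => simp
      | succ k ih =>
        nth_rewrite 2 [← ih]
        nth_rewrite 2 [hinv]
        rw [pow_succ', transpose_mul]
        noncomm_ring
    have ht := Matrix.tendsto_transpose_pow_mul_mul_pow hlim P
    simp only [hk] at ht
    exact tendsto_nhds_unique tendsto_const_nhds ht
  obtain ⟨P, hP⟩ := LinearMap.injective_iff_surjective.1 hinj (-Q)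
  have hPQ : Bᵀ * P + P * B = -Q := hP
  have hQt : Qᵀ = Q := by simpa using hQ.isHermitian.eq
  have hPh : P.IsHermitian := by
    rw [IsHermitian, conjTranspose_eq_transpose_of_trivial]
    refine hinj (Eq.trans ?_ hP.symm)
    change Bᵀ * Pᵀ + Pᵀ * B = -Q
    rw [← hQt, ← transpose_neg, ← hPQ, transpose_add, transpose_mul, transpose_mul,
      transpose_transpose, add_comm]
  have hstep := Matrix.sub_cayley_transpose_mul_mul hS P
  rw [hPQ, neg_neg] at hstep
  have hPpsd : P.PosSemidef := by
    refine .of_sub_transpose_mul_mul hlim hPh ?_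
    rw [hstep]
    exact (hQ.conjTranspose_mul_mul_same S).smul zero_le_two
  refine ⟨P, hPQ, hPpsd, fun P' h' => hinj (h'.trans hP.symm), fun hQd => ?_⟩
  have hSinj : Function.Injective S.mulVec := Matrix.mulVec_injective_of_isUnit
    ⟨⟨S, 1 - B, hS', hS⟩, rfl⟩
  rw [← sub_add_cancel P (((1 + B) * S)ᵀ * P * ((1 + B) * S)), hstep]
  exact ((hQd.conjTranspose_mul_mul_same hSinj).smul two_pos).add_posSemidef
    (hPpsd.conjTranspose_mul_mul_same _)
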